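/- There exists a constant τ_Y > 0, depending only on n and the constants c_Y, C_Y, C_R, c_ρ, A_0, A_1, such that for every 0 < τ ≤ τ_Y, every 0 < ε ≤ τ_Y/10, every smooth ρ : ℝ^{n−1} → (−∞, 0] with |∂_{y'}ρ| ≤ c_ρ and |∂²_{y'}ρ| ≤ c_ρ, and every point (y, ξ) ∈ ℝⁿ × ℝⁿ with y ∈ W(τ, ε) and p_ψ(y, ξ) = 0, the Poisson bracket satisfies {Re p_ψ, Im p_ψ}(y, ξ) > 0; that is, ψ(y) = y_n + 2τρ(y') is a Carleman weight for p on W(τ, ε). -/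

import Mathlib

open scoped BigOperators

noncomputable section

/-- `ℝ^m` with its Euclidean norm. -/
abbrev Esp (m : ℕ) := EuclideanSpace ℝ (Fin m)

/-- The quadratic form with (real) coefficient matrix `M`, evaluated at `v`. -/
noncomputable def quadForm {m : ℕ} (M : Matrix (Fin m) (Fin m) ℝ) (v : Esp m) : ℝ :=
  ∑ i, ∑ j, M i j * v i * v j

/-- The quadratic form with real coefficient matrix `M`, evaluated at a complex
covector `v`. -/
noncomputable def quadFormC {m : ℕ} (M : Matrix (Fin m) (Fin m) ℝ) (v : Fin m → ℂ) : ℂ :=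
  ∑ i, ∑ j, (M i j : ℂ) * v i * v j

/-- The complex tangential covector `ξ' + i ∂_{y'}ψ(y)` where `ψ(y) = (⋯)yₙ + 2τρ(y')`,
so that `∂_{y'_i}ψ = 2τ ∂_{y'_i}ρ(y')`. -/
noncomputable def zetaPrime {m : ℕ} (τ : ℝ) (ρ : Esp m → ℝ) (y' ξ' : Esp m) :
    Fin m → ℂ :=
  fun i => (ξ' i : ℂ) + Complex.I * (2 * τ * fderiv ℝ ρ y' (EuclideanSpace.single i 1))

/-- The Poisson bracket `{f, g} = Σⱼ (∂_{ξⱼ}f ∂_{yⱼ}g − ∂_{yⱼ}f ∂_{ξⱼ}g)` of two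
functions on phase space `ℝⁿ_y × ℝⁿ_ξ`, where `y = (y', yₙ)` and `ξ = (ξ', ξₙ)`. -/
noncomputable def poissonBracket {m : ℕ}
    (f g : (Esp m × ℝ) × (Esp m × ℝ) → ℝ) (z : (Esp m × ℝ) × (Esp m × ℝ)) : ℝ :=
  (∑ j : Fin m,
      (fderiv ℝ f z ((0 : Esp m × ℝ), (EuclideanSpace.single j (1 : ℝ), (0 : ℝ)))
          * fderiv ℝ g z ((EuclideanSpace.single j (1 : ℝ), (0 : ℝ)), (0 : Esp m × ℝ))
        - fderiv ℝ f z ((EuclideanSpace.single j (1 : ℝ), (0 : ℝ)), (0 : Esp m × ℝ))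
          * fderiv ℝ g z ((0 : Esp m × ℝ), (EuclideanSpace.single j (1 : ℝ), (0 : ℝ)))))
    + (fderiv ℝ f z ((0 : Esp m × ℝ), ((0 : Esp m), (1 : ℝ)))
          * fderiv ℝ g z (((0 : Esp m), (1 : ℝ)), (0 : Esp m × ℝ))
        - fderiv ℝ f z (((0 : Esp m), (1 : ℝ)), (0 : Esp m × ℝ))
          * fderiv ℝ g z ((0 : Esp m × ℝ), ((0 : Esp m), (1 : ℝ))))

/-- The conjugated symbol `p_ψ(y, ξ) = p(y, ξ + i ∂_yψ(y))` for
`p(y,ξ) = ξₙ² + a(y',ξ') − 2yₙ b(y',ξ') + R(y,ξ') − 1` and `ψ(y) = yₙ + 2τρ(y')`,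
where `a`, `b`, `R` are the quadratic forms with coefficient matrices `A`, `B`, `R`. -/
noncomputable def pPsi {m : ℕ} (A B : Esp m → Matrix (Fin m) (Fin m) ℝ)
    (R : Esp m × ℝ → Matrix (Fin m) (Fin m) ℝ) (τ : ℝ) (ρ : Esp m → ℝ)
    (z : (Esp m × ℝ) × (Esp m × ℝ)) : ℂ :=
  ((z.2.2 : ℂ) + Complex.I) ^ 2
    + quadFormC (A z.1.1) (zetaPrime τ ρ z.1.1 z.2.1)
    - 2 * (z.1.2 : ℂ) * quadFormC (B z.1.1) (zetaPrime τ ρ z.1.1 z.2.1)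
    + quadFormC (R z.1) (zetaPrime τ ρ z.1.1 z.2.1)
    - 1

/-- The coefficients of `a - 2 yₙ b + R`, with the coefficients of `R` symmetrized. -/
def coefMatrix {m : ℕ} (A B : Esp m → Matrix (Fin m) (Fin m) ℝ)
    (R : Esp m × ℝ → Matrix (Fin m) (Fin m) ℝ) (y : Esp m × ℝ) : Matrix (Fin m) (Fin m) ℝ :=
  fun i j => A y.1 i j - 2 * y.2 * B y.1 i j + (R y i j + R y j i) / 2

/-- The `i`-th tangential derivative of `2τρ`. -/
def weightGrad {m : ℕ} (τ : ℝ) (ρ : Esp m → ℝ) (i : Fin m) (y' : Esp m) : ℝ :=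
  2 * τ * fderiv ℝ ρ y' (EuclideanSpace.single i 1)

lemma sum_sum_mul_symm {m : ℕ} (M f : Fin m → Fin m → ℝ) (hf : ∀ i j, f i j = f j i) :
    ∑ i, ∑ j, (M i j + M j i) / 2 * f i j = ∑ i, ∑ j, M i j * f i j := by
  have h : ∑ i, ∑ j, M j i * f i j = ∑ i, ∑ j, M i j * f i j := by
    rw [Finset.sum_comm]
    simp_rw [fun i j => hf j i]
  calc ∑ i, ∑ j, (M i j + M j i) / 2 * f i j
      = (∑ i, ∑ j, M i j * f i j + ∑ i, ∑ j, M j i * f i j) / 2 := by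
        simp_rw [← Finset.sum_add_distrib, Finset.sum_div]
        refine Finset.sum_congr rfl fun i _ => Finset.sum_congr rfl fun j _ => ?_
        ring
    _ = _ := by rw [h]; ring

lemma sum_sum_coefMatrix {m : ℕ} (A B : Esp m → Matrix (Fin m) (Fin m) ℝ)
    (R : Esp m × ℝ → Matrix (Fin m) (Fin m) ℝ) (y : Esp m × ℝ) (f : Fin m → Fin m → ℝ)
    (hf : ∀ i j, f i j = f j i) :
    ∑ i, ∑ j, coefMatrix A B R y i j * f i j =
      ∑ i, ∑ j, A y.1 i j * f i j - 2 * y.2 * ∑ i, ∑ j, B y.1 i j * f i j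
        + ∑ i, ∑ j, R y i j * f i j := by
  rw [← sum_sum_mul_symm (R y) f hf]
  simp_rw [Finset.mul_sum, ← Finset.sum_sub_distrib, ← Finset.sum_add_distrib]
  refine Finset.sum_congr rfl fun i _ => Finset.sum_congr rfl fun j _ => ?_
  simp only [coefMatrix]
  ring

lemma zetaPrime_apply {m : ℕ} (τ : ℝ) (ρ : Esp m → ℝ) (y' ξ' : Esp m) (i : Fin m) :
    zetaPrime τ ρ y' ξ' i = (ξ' i : ℂ) + Complex.I * (weightGrad τ ρ i y' : ℝ) := by
  simp [zetaPrime, weightGrad]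

lemma quadFormC_zetaPrime_re {m : ℕ} (M : Matrix (Fin m) (Fin m) ℝ) (τ : ℝ) (ρ : Esp m → ℝ)
    (y' ξ' : Esp m) :
    (quadFormC M (zetaPrime τ ρ y' ξ')).re =
      ∑ i, ∑ j, M i j * (ξ' i * ξ' j - weightGrad τ ρ i y' * weightGrad τ ρ j y') := by
  simp only [quadFormC, zetaPrime_apply, Complex.re_sum]
  refine Finset.sum_congr rfl fun i _ => Finset.sum_congr rfl fun j _ => ?_
  simp
  ring

lemma quadFormC_zetaPrime_im {m : ℕ} (M : Matrix (Fin m) (Fin m) ℝ) (τ : ℝ) (ρ : Esp m → ℝ)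
    (y' ξ' : Esp m) :
    (quadFormC M (zetaPrime τ ρ y' ξ')).im =
      ∑ i, ∑ j, M i j * (ξ' i * weightGrad τ ρ j y' + weightGrad τ ρ i y' * ξ' j) := by
  simp only [quadFormC, zetaPrime_apply, Complex.im_sum]
  refine Finset.sum_congr rfl fun i _ => Finset.sum_congr rfl fun j _ => ?_
  simp
  ring

lemma pPsi_re {m : ℕ} (A B : Esp m → Matrix (Fin m) (Fin m) ℝ)
    (R : Esp m × ℝ → Matrix (Fin m) (Fin m) ℝ) (τ : ℝ) (ρ : Esp m → ℝ)
    (w : (Esp m × ℝ) × (Esp m × ℝ)) :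
    (pPsi A B R τ ρ w).re = w.2.2 ^ 2 + ∑ i, ∑ j, coefMatrix A B R w.1 i j *
      (w.2.1 i * w.2.1 j - weightGrad τ ρ i w.1.1 * weightGrad τ ρ j w.1.1) - 2 := by
  rw [sum_sum_coefMatrix _ _ _ _
    (fun i j => w.2.1 i * w.2.1 j - weightGrad τ ρ i w.1.1 * weightGrad τ ρ j w.1.1)
    (fun i j => by ring)]
  simp only [← quadFormC_zetaPrime_re, pPsi]
  simp [pow_two]
  ring

lemma pPsi_im {m : ℕ} (A B : Esp m → Matrix (Fin m) (Fin m) ℝ)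
    (R : Esp m × ℝ → Matrix (Fin m) (Fin m) ℝ) (τ : ℝ) (ρ : Esp m → ℝ)
    (w : (Esp m × ℝ) × (Esp m × ℝ)) :
    (pPsi A B R τ ρ w).im = 2 * w.2.2 + ∑ i, ∑ j, coefMatrix A B R w.1 i j *
      (w.2.1 i * weightGrad τ ρ j w.1.1 + weightGrad τ ρ i w.1.1 * w.2.1 j) := by
  rw [sum_sum_coefMatrix _ _ _ _
    (fun i j => w.2.1 i * weightGrad τ ρ j w.1.1 + weightGrad τ ρ i w.1.1 * w.2.1 j)
    (fun i j => by ring)]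
  simp only [← quadFormC_zetaPrime_im, pPsi]
  simp [pow_two]
  ring

section Derivatives

variable {E : Type*} [NormedAddCommGroup E] [NormedSpace ℝ E] {m : ℕ} {z : E}
  {q : Fin m → Fin m → E → ℝ} {q' : Fin m → Fin m → E →L[ℝ] ℝ}
  {x e : Fin m → E → ℝ} {x' e' : Fin m → E →L[ℝ] ℝ} {s : E → ℝ} {s' : E →L[ℝ] ℝ}

lemma fderiv_re_formula (hq : ∀ i j, HasFDerivAt (q i j) (q' i j) z)
    (hx : ∀ i, HasFDerivAt (x i) (x' i) z) (he : ∀ i, HasFDerivAt (e i) (e' i) z)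
    (hs : HasFDerivAt s s' z) (v : E) :
    fderiv ℝ (fun w => s w ^ 2 + ∑ i, ∑ j, q i j w * (x i w * x j w - e i w * e j w) - 2) z v
      = 2 * s z * s' v + ∑ i, ∑ j, (q' i j v * (x i z * x j z - e i z * e j z)
        + q i j z * (x' i v * x j z + x i z * x' j v - e' i v * e j z - e i z * e' j v)) := by
  have h := ((hs.pow 2).add (HasFDerivAt.fun_sum (u := Finset.univ) fun i _ =>
    HasFDerivAt.fun_sum (u := Finset.univ) fun j _ =>
      (hq i j).mul (((hx i).mul (hx j)).sub ((he i).mul (he j))))).sub_const 2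
  erw [h.fderiv]
  simp only [add_apply, sum_apply,
    smul_apply, sub_apply, smul_eq_mul]
  congr 1
  · simp
  · refine Finset.sum_congr rfl fun i _ => Finset.sum_congr rfl fun j _ => ?_
    simp only [Pi.mul_apply, Pi.sub_apply]
    ring

lemma fderiv_im_formula (hq : ∀ i j, HasFDerivAt (q i j) (q' i j) z)
    (hx : ∀ i, HasFDerivAt (x i) (x' i) z) (he : ∀ i, HasFDerivAt (e i) (e' i) z)
    (hs : HasFDerivAt s s' z) (v : E) :
    fderiv ℝ (fun w => 2 * s w + ∑ i, ∑ j, q i j w * (x i w * e j w + e i w * x j w)) z v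
      = 2 * s' v + ∑ i, ∑ j, (q' i j v * (x i z * e j z + e i z * x j z)
        + q i j z * (x' i v * e j z + x i z * e' j v + e' i v * x j z + e i z * x' j v)) := by
  have h := (hs.const_mul 2).add (HasFDerivAt.fun_sum (u := Finset.univ) fun i _ =>
    HasFDerivAt.fun_sum (u := Finset.univ) fun j _ =>
      (hq i j).mul (((hx i).mul (he j)).add ((he i).mul (hx j))))
  erw [h.fderiv]
  simp only [add_apply, sum_apply,
    smul_apply, smul_eq_mul]
  congr 1
  refine Finset.sum_congr rfl fun i _ => Finset.sum_congr rfl fun j _ => ?_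
  simp only [Pi.mul_apply, Pi.add_apply]
  ring

end Derivatives

lemma abs_sum_sum_le {m : ℕ} {f : Fin m → Fin m → ℝ} {c : ℝ} (h : ∀ i j, |f i j| ≤ c) :
    |∑ i, ∑ j, f i j| ≤ (m : ℝ) ^ 2 * c := by
  calc |∑ i, ∑ j, f i j| ≤ ∑ i : Fin m, ∑ j : Fin m, |f i j| :=
        (Finset.abs_sum_le_sum_abs _ _).trans
          (Finset.sum_le_sum fun i _ => Finset.abs_sum_le_sum_abs _ _)
    _ ≤ ∑ _i : Fin m, ∑ _j : Fin m, c :=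
        Finset.sum_le_sum fun i _ => Finset.sum_le_sum fun j _ => h i j
    _ = _ := by simp; ring

lemma abs_mul_le_mul {a b c d : ℝ} (ha : |a| ≤ c) (hb : |b| ≤ d) : |a * b| ≤ c * d := by
  rw [abs_mul]
  exact mul_le_mul ha hb (abs_nonneg _) ((abs_nonneg _).trans ha)

lemma abs_re_term_le {a K X H d h q' q xi xj ei ej xi' xj' ei' ej' : ℝ}
    (hq' : |q'| ≤ a) (hq : |q| ≤ K) (hxi : |xi| ≤ X) (hxj : |xj| ≤ X) (hei : |ei| ≤ H)
    (hej : |ej| ≤ H) (hxi' : |xi'| ≤ d) (hxj' : |xj'| ≤ d) (hei' : |ei'| ≤ h)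
    (hej' : |ej'| ≤ h) :
    |q' * (xi * xj - ei * ej) + q * (xi' * xj + xi * xj' - ei' * ej - ei * ej')|
      ≤ a * (X ^ 2 + H ^ 2) + K * (2 * d * X + 2 * h * H) := by
  refine (abs_add_le _ _).trans (add_le_add (abs_mul_le_mul hq' ?_) (abs_mul_le_mul hq ?_))
  · have h1 := abs_le.1 (abs_mul_le_mul hxi hxj)
    have h2 := abs_le.1 (abs_mul_le_mul hei hej)
    rw [abs_le]; constructor <;> linarith
  · have h1 := abs_le.1 (abs_mul_le_mul hxi' hxj)
    have h2 := abs_le.1 (abs_mul_le_mul hxi hxj')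
    have h3 := abs_le.1 (abs_mul_le_mul hei' hej)
    have h4 := abs_le.1 (abs_mul_le_mul hei hej')
    rw [abs_le]; constructor <;> linarith

lemma abs_im_term_le {a K X H d h q' q xi xj ei ej xi' xj' ei' ej' : ℝ}
    (hq' : |q'| ≤ a) (hq : |q| ≤ K) (hxi : |xi| ≤ X) (hxj : |xj| ≤ X) (hei : |ei| ≤ H)
    (hej : |ej| ≤ H) (hxi' : |xi'| ≤ d) (hxj' : |xj'| ≤ d) (hei' : |ei'| ≤ h)
    (hej' : |ej'| ≤ h) :
    |q' * (xi * ej + ei * xj) + q * (xi' * ej + xi * ej' + ei' * xj + ei * xj')|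
      ≤ a * (2 * X * H) + K * (2 * d * H + 2 * h * X) := by
  refine (abs_add_le _ _).trans (add_le_add (abs_mul_le_mul hq' ?_) (abs_mul_le_mul hq ?_))
  · have h1 := abs_le.1 (abs_mul_le_mul hxi hej)
    have h2 := abs_le.1 (abs_mul_le_mul hei hxj)
    rw [abs_le]; constructor <;> linarith
  · have h1 := abs_le.1 (abs_mul_le_mul hxi' hej)
    have h2 := abs_le.1 (abs_mul_le_mul hxi hej')
    have h3 := abs_le.1 (abs_mul_le_mul hei' hxj)
    have h4 := abs_le.1 (abs_mul_le_mul hei hxj')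
    rw [abs_le]; constructor <;> linarith

lemma bracket_pos_of_bounds {m : ℕ} {Fξ Fy Gξ Gy : Fin m → ℝ} {Fn Gn ξn b X t P c : ℝ}
    (hP : 1 ≤ P) (hmP : (m : ℝ) ≤ P) (ht : 0 < t) (ht1 : t ≤ 1) (htP : P ^ 3 * t ≤ 1)
    (htc : 16 * P ^ 10 * t ≤ c)
    (hFξ : ∀ j, |Fξ j| ≤ 2 * P * X) (hGy : ∀ j, |Gy j| ≤ 4 * P ^ 2 * t * X)
    (hFy : ∀ j, |Fy j| ≤ P * (X ^ 2 + 3 * P ^ 2 * t ^ 2)) (hGξ : ∀ j, |Gξ j| ≤ 2 * P ^ 2 * t)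
    (hGn : |Gn| ≤ 2 * P ^ 2 * t * X) (hξn : |ξn| ≤ P ^ 2 * t * X)
    (hFn : Fn ≤ -2 * b + P * (t * X ^ 2 + P ^ 2 * t ^ 2)) (hb : c * X ^ 2 ≤ b)
    (hlow : 2 ≤ ξn ^ 2 + P * X ^ 2 + P ^ 3 * t ^ 2) :
    0 < ∑ j, (Fξ j * Gy j - Fy j * Gξ j) + (2 * ξn * Gn - Fn * 2) := by
  have hP0 : 0 < P := by linarith
  have hpow : ∀ {k l : ℕ}, k ≤ l → P ^ k ≤ P ^ l := fun h => pow_le_pow_right₀ hP h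
  have htt : t ^ 2 ≤ t := by nlinarith
  have hX2 : 1 ≤ 2 * P ^ 4 * X ^ 2 := by
    have h1 : ξn ^ 2 ≤ (P ^ 2 * t * X) ^ 2 := sq_le_sq' (by linarith [(abs_le.1 hξn).1])
      (abs_le.1 hξn).2
    have h2 : (P ^ 2 * t * X) ^ 2 ≤ P ^ 4 * X ^ 2 := by
      have : P ^ 4 * X ^ 2 * t ^ 2 ≤ P ^ 4 * X ^ 2 * 1 := by gcongr; linarith
      nlinarith
    have h3 : P * X ^ 2 ≤ P ^ 4 * X ^ 2 := by
      gcongr; simpa using hpow (show 1 ≤ 4 by norm_num)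
    have h4 : P ^ 3 * t ^ 2 ≤ P ^ 3 * t := by gcongr
    linarith
  have hsum : |∑ j, (Fξ j * Gy j - Fy j * Gξ j)|
      ≤ P * (8 * P ^ 3 * t * X ^ 2 + 2 * P ^ 3 * t * (X ^ 2 + 3 * P ^ 2 * t ^ 2)) := by
    calc |∑ j, (Fξ j * Gy j - Fy j * Gξ j)|
        ≤ ∑ _j : Fin m, (8 * P ^ 3 * t * X ^ 2 + 2 * P ^ 3 * t * (X ^ 2 + 3 * P ^ 2 * t ^ 2)) := by
          refine (Finset.abs_sum_le_sum_abs _ _).trans (Finset.sum_le_sum fun j _ => ?_)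
          have h1 := abs_le.1 (abs_mul_le_mul (hFξ j) (hGy j))
          have h2 := abs_le.1 (abs_mul_le_mul (hFy j) (hGξ j))
          rw [abs_le]; constructor <;> linarith
      _ = (m : ℝ) * (8 * P ^ 3 * t * X ^ 2
            + 2 * P ^ 3 * t * (X ^ 2 + 3 * P ^ 2 * t ^ 2)) := by simp; ring
      _ ≤ _ := by gcongr
  have hprod := (abs_le.1 (abs_mul_le_mul hξn hGn)).1
  have hE1 : P ^ 4 * t ^ 2 * X ^ 2 ≤ P ^ 6 * t * X ^ 2 := by
    gcongr ?_ * ?_ * _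
    exact hpow (by norm_num)
  have hE2 : P ^ 4 * t * X ^ 2 ≤ P ^ 6 * t * X ^ 2 := by
    gcongr ?_ * _ * _
    exact hpow (by norm_num)
  have hE3 : P ^ 6 * t ^ 3 ≤ P ^ 6 * t := by
    gcongr
    nlinarith
  have hE4 : P * (t * X ^ 2) ≤ P ^ 6 * t * X ^ 2 := by
    rw [← mul_assoc]
    gcongr
    simpa using hpow (show 1 ≤ 6 by norm_num)
  have hE5 : P ^ 3 * t ^ 2 ≤ P ^ 6 * t := by
    gcongr ?_ * ?_
    exact hpow (by norm_num)
  have hmain : 16 * P ^ 6 * t * (1 + X ^ 2) ≤ 3 * (c * X ^ 2) := by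
    have h1 : 16 * P ^ 6 * t * 1 ≤ 16 * P ^ 6 * t * (2 * P ^ 4 * X ^ 2) := by gcongr
    have h2 : 16 * P ^ 6 * t * X ^ 2 ≤ 16 * P ^ 10 * t * X ^ 2 := by
      gcongr ?_ * ?_ * _ * _
      exact hpow (by norm_num)
    have h3 : 16 * P ^ 10 * t * X ^ 2 ≤ c * X ^ 2 := by gcongr
    nlinarith
  have hc : 0 < c * X ^ 2 := by
    have h1 : 0 < c := lt_of_lt_of_le (by positivity) htc
    have h2 : 0 < X ^ 2 := by
      by_contra h
      have : X ^ 2 = 0 := le_antisymm (not_lt.1 h) (sq_nonneg X)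
      rw [this] at hX2
      norm_num at hX2
    positivity
  have := (abs_le.1 hsum).1
  nlinarith

lemma quadForm_single {m : ℕ} (M : Matrix (Fin m) (Fin m) ℝ) (i : Fin m) :
    quadForm M (EuclideanSpace.single i 1) = M i i := by
  simp [quadForm]

lemma quadForm_single_add_single {m : ℕ} (M : Matrix (Fin m) (Fin m) ℝ) (i j : Fin m) :
    quadForm M (EuclideanSpace.single i 1 + EuclideanSpace.single j 1)
      = M i i + M i j + M j i + M j j := by
  simp [quadForm, mul_add, Finset.sum_add_distrib]
  ring

lemma symm_coeff_eq_polarization {m : ℕ} (M : Matrix (Fin m) (Fin m) ℝ) (i j : Fin m) :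
    (M i j + M j i) / 2 =
      (quadForm M (EuclideanSpace.single i 1 + EuclideanSpace.single j 1)
        - quadForm M (EuclideanSpace.single i 1) - quadForm M (EuclideanSpace.single j 1)) / 2 := by
  rw [quadForm_single_add_single, quadForm_single, quadForm_single]
  ring

lemma norm_single_add_single_sq_le {m : ℕ} (i j : Fin m) :
    ‖(EuclideanSpace.single i 1 + EuclideanSpace.single j 1 : Esp m)‖ ^ 2 ≤ 4 := by
  have h : ‖(EuclideanSpace.single i 1 + EuclideanSpace.single j 1 : Esp m)‖ ≤ 2 :=
    (norm_add_le _ _).trans (by simp; norm_num)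
  nlinarith [norm_nonneg (EuclideanSpace.single i 1 + EuclideanSpace.single j 1 : Esp m)]

lemma abs_symm_coeff_le {m : ℕ} {M : Matrix (Fin m) (Fin m) ℝ} {C : ℝ} (hC : 0 ≤ C)
    (h : ∀ v : Esp m, |quadForm M v| ≤ C * ‖v‖ ^ 2) (i j : Fin m) :
    |(M i j + M j i) / 2| ≤ 3 * C := by
  rw [symm_coeff_eq_polarization]
  have h1 := abs_le.1 (h (EuclideanSpace.single i 1 + EuclideanSpace.single j 1))
  have h2 := abs_le.1 (h (EuclideanSpace.single i 1))
  have h3 := abs_le.1 (h (EuclideanSpace.single j 1))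
  have h4 := mul_le_mul_of_nonneg_left (norm_single_add_single_sq_le i j) hC
  simp only [PiLp.norm_single, norm_one, one_pow, mul_one] at h2 h3
  rw [abs_le]; constructor <;> linarith

lemma abs_fderiv_symm_coeff_le {m : ℕ} {R : Esp m × ℝ → Matrix (Fin m) (Fin m) ℝ}
    {y : Esp m × ℝ} {C : ℝ} (hC : 0 ≤ C)
    (hR : ∀ i j, DifferentiableAt ℝ (fun y => R y i j) y)
    (h : ∀ v : Esp m, ‖fderiv ℝ (fun w => quadForm (R w) v) y‖ ≤ C * ‖v‖ ^ 2) (i j : Fin m)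
    (v : Esp m × ℝ) (hv : ‖v‖ ≤ 1) :
    |fderiv ℝ (fun w => (R w i j + R w j i) / 2) y v| ≤ 3 * C := by
  have hd : ∀ u : Esp m, HasFDerivAt (fun w => quadForm (R w) u)
      (fderiv ℝ (fun w => quadForm (R w) u) y) y := fun u =>
    (DifferentiableAt.fun_sum fun a _ => DifferentiableAt.fun_sum fun b _ =>
      ((hR a b).mul_const _).mul_const _).hasFDerivAt
  have hb : ∀ u : Esp m, |fderiv ℝ (fun w => quadForm (R w) u) y v| ≤ C * ‖u‖ ^ 2 := fun u =>
    (ContinuousLinearMap.le_of_opNorm_le _ (h u) v).trans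
      (mul_le_of_le_one_right (by positivity) hv)
  simp_rw [symm_coeff_eq_polarization]
  have hpol := (((hd (EuclideanSpace.single i 1 + EuclideanSpace.single j 1)).sub
    (hd (EuclideanSpace.single i 1))).sub (hd (EuclideanSpace.single j 1))).mul_const (2⁻¹ : ℝ)
  simp_rw [div_eq_mul_inv]
  erw [hpol.fderiv]
  simp only [smul_apply, sub_apply, smul_eq_mul]
  have h1 := abs_le.1 (hb (EuclideanSpace.single i 1 + EuclideanSpace.single j 1))
  have h2 := abs_le.1 (hb (EuclideanSpace.single i 1))
  have h3 := abs_le.1 (hb (EuclideanSpace.single j 1))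
  have h4 := mul_le_mul_of_nonneg_left (norm_single_add_single_sq_le i j) hC
  simp only [PiLp.norm_single, norm_one, one_pow, mul_one] at h2 h3
  rw [abs_le]; constructor <;> linarith

lemma fderiv_coefMatrix {m : ℕ} {A B : Esp m → Matrix (Fin m) (Fin m) ℝ}
    {R : Esp m × ℝ → Matrix (Fin m) (Fin m) ℝ} {y : Esp m × ℝ}
    (hA : ∀ i j, DifferentiableAt ℝ (fun w => A w i j) y.1)
    (hB : ∀ i j, DifferentiableAt ℝ (fun w => B w i j) y.1)
    (hR : ∀ i j, DifferentiableAt ℝ (fun w => R w i j) y) (i j : Fin m) :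
    DifferentiableAt ℝ (fun w => coefMatrix A B R w i j) y ∧
    ∀ v, fderiv ℝ (fun w => coefMatrix A B R w i j) y v =
      fderiv ℝ (fun w => A w i j) y.1 v.1
        - 2 * (v.2 * B y.1 i j + y.2 * fderiv ℝ (fun w => B w i j) y.1 v.1)
        + fderiv ℝ (fun w => (R w i j + R w j i) / 2) y v := by
  have h1 := (hA i j).hasFDerivAt.comp y hasFDerivAt_fst
  have h2 := ((hasFDerivAt_snd (𝕜 := ℝ) (p := y)).const_mul (2 : ℝ)).mul
    ((hB i j).hasFDerivAt.comp y hasFDerivAt_fst)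
  have h3 : DifferentiableAt ℝ (fun w => (R w i j + R w j i) / 2) y := by
    have hij := hR i j
    have hji := hR j i
    fun_prop
  have h := (h1.sub h2).add h3.hasFDerivAt
  refine ⟨h.differentiableAt, fun v => ?_⟩
  erw [h.fderiv]
  simp only [add_apply, sub_apply, smul_apply, smul_eq_mul, ContinuousLinearMap.comp_apply,
    ContinuousLinearMap.coe_fst', ContinuousLinearMap.coe_snd', Function.comp_apply]
  ring

lemma fderiv_weightGrad {m : ℕ} (τ : ℝ) {ρ : Esp m → ℝ} (hρ : ContDiff ℝ (⊤ : ℕ∞) ρ)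
    (i : Fin m) (y' : Esp m) :
    DifferentiableAt ℝ (weightGrad τ ρ i) y' ∧ ∀ v, fderiv ℝ (weightGrad τ ρ i) y' v =
      2 * τ * fderiv ℝ (fderiv ℝ ρ) y' v (EuclideanSpace.single i 1) := by
  have hd : DifferentiableAt ℝ (fderiv ℝ ρ) y' :=
    ((contDiff_infty_iff_fderiv.1 hρ).2.differentiable (by simp)) y'
  have h := (hd.hasFDerivAt.clm_apply
    (hasFDerivAt_const (EuclideanSpace.single i (1 : ℝ) : Esp m) y')).const_mul (2 * τ)
  refine ⟨h.differentiableAt, fun v => ?_⟩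
  erw [h.fderiv]
  simp

section Bracket

variable {m : ℕ} {A B : Esp m → Matrix (Fin m) (Fin m) ℝ}
  {R : Esp m × ℝ → Matrix (Fin m) (Fin m) ℝ} {τ : ℝ} {ρ : Esp m → ℝ}
  {z : (Esp m × ℝ) × (Esp m × ℝ)}

lemma fderiv_pPsi (hQ : ∀ i j, DifferentiableAt ℝ (fun w => coefMatrix A B R w i j) z.1)
    (hη : ∀ i, DifferentiableAt ℝ (weightGrad τ ρ i) z.1.1) (v : (Esp m × ℝ) × (Esp m × ℝ)) :
    (fderiv ℝ (fun w => (pPsi A B R τ ρ w).re) z v = 2 * z.2.2 * v.2.2 + ∑ i, ∑ j,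
      (fderiv ℝ (fun w => coefMatrix A B R w i j) z.1 v.1 *
          (z.2.1 i * z.2.1 j - weightGrad τ ρ i z.1.1 * weightGrad τ ρ j z.1.1)
        + coefMatrix A B R z.1 i j * (v.2.1 i * z.2.1 j + z.2.1 i * v.2.1 j
          - fderiv ℝ (weightGrad τ ρ i) z.1.1 v.1.1 * weightGrad τ ρ j z.1.1
          - weightGrad τ ρ i z.1.1 * fderiv ℝ (weightGrad τ ρ j) z.1.1 v.1.1))) ∧
    (fderiv ℝ (fun w => (pPsi A B R τ ρ w).im) z v = 2 * v.2.2 + ∑ i, ∑ j,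
      (fderiv ℝ (fun w => coefMatrix A B R w i j) z.1 v.1 *
          (z.2.1 i * weightGrad τ ρ j z.1.1 + weightGrad τ ρ i z.1.1 * z.2.1 j)
        + coefMatrix A B R z.1 i j * (v.2.1 i * weightGrad τ ρ j z.1.1
          + z.2.1 i * fderiv ℝ (weightGrad τ ρ j) z.1.1 v.1.1
          + fderiv ℝ (weightGrad τ ρ i) z.1.1 v.1.1 * z.2.1 j
          + weightGrad τ ρ i z.1.1 * v.2.1 j))) := by
  have hq : ∀ i j, HasFDerivAt
      (fun w : (Esp m × ℝ) × (Esp m × ℝ) => coefMatrix A B R w.1 i j)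
      ((fderiv ℝ (fun w => coefMatrix A B R w i j) z.1).comp (.fst ℝ _ _)) z :=
    fun i j => (hQ i j).hasFDerivAt.comp z hasFDerivAt_fst
  have he : ∀ i, HasFDerivAt (fun w : (Esp m × ℝ) × (Esp m × ℝ) => weightGrad τ ρ i w.1.1)
      ((fderiv ℝ (weightGrad τ ρ i) z.1.1).comp
        ((ContinuousLinearMap.fst ℝ (Esp m) ℝ).comp (.fst ℝ _ _))) z :=
    fun i => HasFDerivAt.comp (f := fun w : (Esp m × ℝ) × (Esp m × ℝ) => w.1.1) z
      (hη i).hasFDerivAt (ContinuousLinearMap.hasFDerivAt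
        ((ContinuousLinearMap.fst ℝ (Esp m) ℝ).comp (.fst ℝ _ (Esp m × ℝ))))
  have hx : ∀ i, HasFDerivAt (fun w : (Esp m × ℝ) × (Esp m × ℝ) => w.2.1 i)
      ((EuclideanSpace.proj i : Esp m →L[ℝ] ℝ).comp
        ((ContinuousLinearMap.fst ℝ (Esp m) ℝ).comp (.snd ℝ _ _))) z :=
    fun i => ContinuousLinearMap.hasFDerivAt ((EuclideanSpace.proj i : Esp m →L[ℝ] ℝ).comp
        ((ContinuousLinearMap.fst ℝ (Esp m) ℝ).comp (.snd ℝ (Esp m × ℝ) _)))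
  have hs : HasFDerivAt (fun w : (Esp m × ℝ) × (Esp m × ℝ) => w.2.2)
      ((ContinuousLinearMap.snd ℝ (Esp m) ℝ).comp (.snd ℝ _ _)) z :=
    ContinuousLinearMap.hasFDerivAt
      ((ContinuousLinearMap.snd ℝ (Esp m) ℝ).comp (.snd ℝ (Esp m × ℝ) _))
  simp_rw [pPsi_re, pPsi_im]
  exact ⟨fderiv_re_formula hq hx he hs v, fderiv_im_formula hq hx he hs v⟩

lemma poissonBracket_pPsi_pos {t K P c : ℝ}
    (hQd : ∀ i j, DifferentiableAt ℝ (fun w => coefMatrix A B R w i j) z.1)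
    (hηd : ∀ i, DifferentiableAt ℝ (weightGrad τ ρ i) z.1.1)
    (hP : 1 ≤ P) (hmP : (m : ℝ) ≤ P) (hKP : K ≤ P) (hmKP : (m : ℝ) ^ 2 * K ≤ P) (hK : 0 ≤ K)
    (ht : 0 < t) (ht1 : t ≤ 1) (htP : P ^ 3 * t ≤ 1) (htc : 16 * P ^ 10 * t ≤ c)
    (hQ : ∀ i j, |coefMatrix A B R z.1 i j| ≤ K)
    (hQ' : ∀ i j k, |fderiv ℝ (fun w => coefMatrix A B R w i j) z.1
      (EuclideanSpace.single k (1 : ℝ), (0 : ℝ))| ≤ K)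
    (hQn : ∀ i j, |fderiv ℝ (fun w => coefMatrix A B R w i j) z.1 ((0 : Esp m), (1 : ℝ))| ≤ K)
    (hQB : ∀ i j, |fderiv ℝ (fun w => coefMatrix A B R w i j) z.1 ((0 : Esp m), (1 : ℝ))
      + 2 * B z.1.1 i j| ≤ K * t)
    (hη : ∀ i, |weightGrad τ ρ i z.1.1| ≤ K * t)
    (hη' : ∀ i k, |fderiv ℝ (weightGrad τ ρ i) z.1.1 (EuclideanSpace.single k (1 : ℝ))| ≤ K * t)
    (hb : c * ‖z.2.1‖ ^ 2 ≤ quadForm (B z.1.1) z.2.1)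
    (hz : pPsi A B R τ ρ z = 0) :
    0 < poissonBracket (fun w => (pPsi A B R τ ρ w).re) (fun w => (pPsi A B R τ ρ w).im) z := by
  set X := ‖z.2.1‖
  have hX : 0 ≤ X := norm_nonneg _
  have hx : ∀ i, |z.2.1 i| ≤ X := fun i => by
    simpa using PiLp.norm_apply_le z.2.1 i
  have hδ : ∀ k i : Fin m, |(EuclideanSpace.single k (1 : ℝ) : Esp m) i| ≤ 1 := fun k i => by
    simpa using PiLp.norm_apply_le (EuclideanSpace.single k (1 : ℝ) : Esp m) i
  have hre := pPsi_re A B R τ ρ z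
  have him := pPsi_im A B R τ ρ z
  rw [hz, Complex.zero_re] at hre
  rw [hz, Complex.zero_im] at him
  have hmKt : (m : ℝ) ^ 2 * K * (K * t) ≤ P ^ 2 * t := by
    have : (m : ℝ) ^ 2 * K * (K * t) ≤ P * (P * t) := by gcongr
    linarith
  have hKt2 : (m : ℝ) ^ 2 * K * (K * t) ^ 2 ≤ P ^ 3 * t ^ 2 := by
    have : (m : ℝ) ^ 2 * K * (K * t) ^ 2 ≤ P * (P * t) ^ 2 := by gcongr
    linarith
  have hmX : ∀ {r : ℝ}, 0 ≤ r → (m : ℝ) ^ 2 * K * r ≤ P * r := fun hr => by gcongr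
  refine bracket_pos_of_bounds (b := quadForm (B z.1.1) z.2.1) (X := X) (t := t) (P := P)
    (c := c) (ξn := z.2.2)
    (Fξ := fun j => fderiv ℝ (fun w => (pPsi A B R τ ρ w).re) z
      ((0 : Esp m × ℝ), (EuclideanSpace.single j (1 : ℝ), (0 : ℝ))))
    (Fy := fun j => fderiv ℝ (fun w => (pPsi A B R τ ρ w).re) z
      ((EuclideanSpace.single j (1 : ℝ), (0 : ℝ)), (0 : Esp m × ℝ)))
    (Gξ := fun j => fderiv ℝ (fun w => (pPsi A B R τ ρ w).im) z
      ((0 : Esp m × ℝ), (EuclideanSpace.single j (1 : ℝ), (0 : ℝ))))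
    (Gy := fun j => fderiv ℝ (fun w => (pPsi A B R τ ρ w).im) z
      ((EuclideanSpace.single j (1 : ℝ), (0 : ℝ)), (0 : Esp m × ℝ)))
    (Fn := fderiv ℝ (fun w => (pPsi A B R τ ρ w).re) z (((0 : Esp m), (1 : ℝ)), (0 : Esp m × ℝ)))
    (Gn := fderiv ℝ (fun w => (pPsi A B R τ ρ w).im) z (((0 : Esp m), (1 : ℝ)), (0 : Esp m × ℝ)))
    hP hmP ht ht1 htP htc ?_ ?_ ?_ ?_ ?_ ?_ ?_ hb ?_ |>.trans_eq ?_
  · intro k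
    rw [(fderiv_pPsi hQd hηd _).1, mul_zero, zero_add]
    refine (abs_sum_sum_le fun i j => abs_re_term_le (a := 0) (d := 1) (h := 0) (by simp)
      (hQ i j) (hx i) (hx j) (hη i) (hη j) (hδ k i) (hδ k j) (by simp) (by simp)).trans ?_
    linarith [hmX hX]
  · intro k
    rw [(fderiv_pPsi hQd hηd _).2]
    simp only [Prod.snd_zero, mul_zero, zero_add]
    refine (abs_sum_sum_le fun i j => abs_im_term_le (a := K) (d := 0) (h := K * t) (hQ' i j k)
      (hQ i j) (hx i) (hx j) (hη i) (hη j) (by simp) (by simp) (hη' i k) (hη' j k)).trans ?_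
    linarith [mul_le_mul_of_nonneg_right hmKt hX]
  · intro k
    rw [(fderiv_pPsi hQd hηd _).1]
    simp only [Prod.snd_zero, mul_zero, zero_add]
    refine (abs_sum_sum_le fun i j => abs_re_term_le (a := K) (d := 0) (h := K * t) (hQ' i j k)
      (hQ i j) (hx i) (hx j) (hη i) (hη j) (by simp) (by simp) (hη' i k) (hη' j k)).trans ?_
    linarith [hmX (sq_nonneg X)]
  · intro k
    rw [(fderiv_pPsi hQd hηd _).2, mul_zero, zero_add]
    refine (abs_sum_sum_le fun i j => abs_im_term_le (a := 0) (d := 1) (h := 0) (by simp)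
      (hQ i j) (hx i) (hx j) (hη i) (hη j) (hδ k i) (hδ k j) (by simp) (by simp)).trans ?_
    linarith
  · rw [(fderiv_pPsi hQd hηd _).2]
    simp only [Prod.snd_zero, mul_zero, zero_add]
    refine (abs_sum_sum_le fun i j => abs_im_term_le (a := K) (d := 0) (h := 0) (hQn i j)
      (hQ i j) (hx i) (hx j) (hη i) (hη j) (by simp) (by simp) (by simp) (by simp)).trans ?_
    linarith [mul_le_mul_of_nonneg_right hmKt hX]
  · have h := abs_sum_sum_le (m := m) (c := K * (2 * X * (K * t))) fun i j =>
      abs_mul_le_mul (hQ i j) (show |z.2.1 i * weightGrad τ ρ j z.1.1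
        + weightGrad τ ρ i z.1.1 * z.2.1 j| ≤ 2 * X * (K * t) from by
          have h1 := abs_mul_le_mul (hx i) (hη j)
          have h2 := abs_mul_le_mul (hη i) (hx j)
          exact (abs_add_le _ _).trans (by linarith))
    have h1 := abs_le.1 h
    have h2 := mul_le_mul_of_nonneg_right hmKt hX
    rw [abs_le]; constructor <;> linarith
  · rw [(fderiv_pPsi hQd hηd _).1]
    simp only [Prod.snd_zero, Prod.fst_zero, mul_zero, zero_add, map_zero, zero_mul,
      PiLp.zero_apply, sub_zero, add_zero]
    have hsplit : ∑ i, ∑ j, fderiv ℝ (fun w => coefMatrix A B R w i j) z.1 ((0 : Esp m), (1 : ℝ)) *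
          (z.2.1 i * z.2.1 j - weightGrad τ ρ i z.1.1 * weightGrad τ ρ j z.1.1)
        = -2 * quadForm (B z.1.1) z.2.1 + ∑ i, ∑ j,
          ((fderiv ℝ (fun w => coefMatrix A B R w i j) z.1 ((0 : Esp m), (1 : ℝ))
            + 2 * B z.1.1 i j) * (z.2.1 i * z.2.1 j)
          - fderiv ℝ (fun w => coefMatrix A B R w i j) z.1 ((0 : Esp m), (1 : ℝ))
            * (weightGrad τ ρ i z.1.1 * weightGrad τ ρ j z.1.1)) := by
      simp_rw [quadForm, Finset.mul_sum, ← Finset.sum_add_distrib]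
      refine Finset.sum_congr rfl fun i _ => Finset.sum_congr rfl fun j _ => ?_
      ring
    rw [hsplit]
    have h := abs_sum_sum_le (m := m) fun i j => (abs_sub _ _).trans (add_le_add
      (abs_mul_le_mul (hQB i j) (abs_mul_le_mul (hx i) (hx j)))
      (abs_mul_le_mul (hQn i j) (abs_mul_le_mul (hη i) (hη j))))
    have h2 := hmX (mul_nonneg ht.le (sq_nonneg X))
    linarith [(abs_le.1 h).2]
  · have h := abs_sum_sum_le (m := m) (c := K * (X * X + K * t * (K * t))) fun i j =>
      abs_mul_le_mul (hQ i j) (show |z.2.1 i * z.2.1 j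
        - weightGrad τ ρ i z.1.1 * weightGrad τ ρ j z.1.1| ≤ X * X + K * t * (K * t) from
          (abs_sub _ _).trans (add_le_add (abs_mul_le_mul (hx i) (hx j))
            (abs_mul_le_mul (hη i) (hη j))))
    linarith [(abs_le.1 h).2, hmX (sq_nonneg X)]
  · have hFn : fderiv ℝ (fun w => (pPsi A B R τ ρ w).re) z
        ((0 : Esp m × ℝ), ((0 : Esp m), (1 : ℝ))) = 2 * z.2.2 := by
      rw [(fderiv_pPsi hQd hηd _).1]
      simp
    have hGn : fderiv ℝ (fun w => (pPsi A B R τ ρ w).im) z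
        ((0 : Esp m × ℝ), ((0 : Esp m), (1 : ℝ))) = 2 := by
      rw [(fderiv_pPsi hQd hηd _).2]
      simp
    rw [poissonBracket, hFn, hGn]

end Bracket

/-- there is `τ_Y > 0`, depending only on `n = m + 1` and the constants
`c_Y, C_Y, C_R, c_ρ, A₀, A₁`, such that for all data `a, b, R` as in the context, all
`0 < τ ≤ τ_Y`, `0 < ε ≤ τ_Y/10`, all smooth `ρ ≤ 0` with first and second derivatives
bounded by `c_ρ`, and every `(y, ξ)` with `y ∈ W(τ, ε)` and `p_ψ(y, ξ) = 0`, one has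
`{Re p_ψ, Im p_ψ}(y, ξ) > 0`; i.e. `ψ(y) = yₙ + 2τρ(y')` is a Carleman weight on
`W(τ, ε)`. -/
theorem statement0 (m : ℕ) (hm : 1 ≤ m)
    (cY CY CR cρ A0 A1 : ℝ)
    (hcY : 0 < cY) (hCY : 0 < CY) (hCR : 0 < CR) (hcρ : 0 < cρ)
    (hA0 : 0 < A0) (hA1 : 0 < A1) :
    ∃ τY : ℝ, 0 < τY ∧
      ∀ (A B : Esp m → Matrix (Fin m) (Fin m) ℝ)
        (R : Esp m × ℝ → Matrix (Fin m) (Fin m) ℝ),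
        -- smooth dependence of the coefficients of `a`, `b` on `y'` in `{‖y'‖ < 2c_Y}`
        (∀ i j, ContDiffOn ℝ (⊤ : ℕ∞) (fun y' => A y' i j) {y' : Esp m | ‖y'‖ < 2 * cY}) →
        (∀ i j, ContDiffOn ℝ (⊤ : ℕ∞) (fun y' => B y' i j) {y' : Esp m | ‖y'‖ < 2 * cY}) →
        -- smooth dependence of the coefficients of `R` on `y`
        (∀ i j, ContDiff ℝ (⊤ : ℕ∞) (fun y => R y i j)) →
        -- `A₁|ξ'|² ≤ a(y',ξ')`
        (∀ y' : Esp m, ‖y'‖ < 2 * cY → ∀ ξ' : Esp m,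
          A1 * ‖ξ'‖ ^ 2 ≤ quadForm (A y') ξ') →
        -- `b(y',ξ') ≥ C_Y a(y',ξ')`
        (∀ y' : Esp m, ‖y'‖ < 2 * cY → ∀ ξ' : Esp m,
          CY * quadForm (A y') ξ' ≤ quadForm (B y') ξ') →
        -- coefficients of `a`, `b` and their first `y'`-derivatives bounded by `A₀`
        (∀ y' : Esp m, ‖y'‖ < 2 * cY → ∀ i j,
          |A y' i j| ≤ A0 ∧ |B y' i j| ≤ A0 ∧
          ∀ k, |fderiv ℝ (fun w => A w i j) y' (EuclideanSpace.single k (1 : ℝ))| ≤ A0 ∧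
               |fderiv ℝ (fun w => B w i j) y' (EuclideanSpace.single k (1 : ℝ))| ≤ A0) →
        -- `|R(y,ξ')| ≤ C_R yₙ²|ξ'|²` and `|∂_y R(y,ξ')| ≤ C_R |yₙ| |ξ'|²` for `|yₙ| ≤ 1`
        (∀ y : Esp m × ℝ, |y.2| ≤ 1 → ∀ ξ' : Esp m,
          |quadForm (R y) ξ'| ≤ CR * y.2 ^ 2 * ‖ξ'‖ ^ 2 ∧
          ‖fderiv ℝ (fun w => quadForm (R w) ξ') y‖ ≤ CR * |y.2| * ‖ξ'‖ ^ 2) →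
        ∀ τ : ℝ, 0 < τ → τ ≤ τY →
        ∀ ε : ℝ, 0 < ε → ε ≤ τY / 10 →
        ∀ ρ : Esp m → ℝ, ContDiff ℝ (⊤ : ℕ∞) ρ → (∀ y', ρ y' ≤ 0) →
          (∀ y', ‖fderiv ℝ ρ y'‖ ≤ cρ) →
          (∀ y', ‖fderiv ℝ (fderiv ℝ ρ) y'‖ ≤ cρ) →
        ∀ z : (Esp m × ℝ) × (Esp m × ℝ),
          -- `y ∈ W(τ, ε)`
          ‖z.1.1‖ < cY → -(2 * ε) < z.1.2 → z.1.2 < τ + 2 * ε →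
          -- on the characteristic set `{p_ψ = 0}`
          pPsi A B R τ ρ z = 0 →
          0 < poissonBracket (fun w => (pPsi A B R τ ρ w).re)
              (fun w => (pPsi A B R τ ρ w).im) z := by
  obtain ⟨K, hKdef⟩ : ∃ K : ℝ, K = 5 * A0 + 12 * CR + 2 * cρ := ⟨_, rfl⟩
  have hK : 0 < K := by rw [hKdef]; positivity
  obtain ⟨P, hPdef⟩ : ∃ P : ℝ, P = (1 + (m : ℝ)) ^ 2 * (1 + K) := ⟨_, rfl⟩
  have hm0 : (0 : ℝ) ≤ m := by positivity
  have hm1 : (1 : ℝ) ≤ (1 + (m : ℝ)) ^ 2 := by nlinarith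
  have hP : 1 ≤ P := by nlinarith
  have hP0 : 0 < P := by linarith
  have hmP : (m : ℝ) ≤ P := by nlinarith
  have hKP : K ≤ P := by nlinarith
  have hmKP : (m : ℝ) ^ 2 * K ≤ P := by
    rw [hPdef]
    apply mul_le_mul <;> nlinarith
  obtain ⟨t, ht, ht2, htP, htc⟩ : ∃ t : ℝ, 0 < t ∧ t ≤ 1 / 2 ∧ P ^ 3 * t ≤ 1 ∧
      16 * P ^ 10 * t ≤ CY * A1 := by
    refine ⟨min (1 / 2) (min (1 / P ^ 3) (CY * A1 / (16 * P ^ 10))), by positivity,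
      min_le_left _ _, ?_, ?_⟩
    · rw [← le_div_iff₀' (by positivity)]
      exact (min_le_right _ _).trans (min_le_left _ _)
    · rw [← le_div_iff₀' (by positivity)]
      exact (min_le_right _ _).trans (min_le_right _ _)
  refine ⟨t, ht, fun A B R hA hB hR hAlow hBlow hAB hRb τ hτ hτt ε hε hεt ρ hρ _ hρ1 hρ2 z hz
    hzl hzr hp => ?_⟩
  have hz2 : ‖z.1.1‖ < 2 * cY := by linarith
  have hopen : {y' : Esp m | ‖y'‖ < 2 * cY} ∈ nhds z.1.1 :=
    (isOpen_lt continuous_norm continuous_const).mem_nhds hz2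
  have hAd : ∀ i j, DifferentiableAt ℝ (fun w => A w i j) z.1.1 := fun i j =>
    ((hA i j).contDiffAt hopen).differentiableAt (by simp)
  have hBd : ∀ i j, DifferentiableAt ℝ (fun w => B w i j) z.1.1 := fun i j =>
    ((hB i j).contDiffAt hopen).differentiableAt (by simp)
  have hRd : ∀ i j, DifferentiableAt ℝ (fun w => R w i j) z.1 := fun i j =>
    (hR i j).contDiffAt.differentiableAt (by simp)
  have hQd := fun i j => fderiv_coefMatrix hAd hBd hRd i j
  have hηd := fun i => fderiv_weightGrad τ hρ i z.1.1
  have hy : |z.1.2| ≤ 2 * t := by rw [abs_le]; constructor <;> linarith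
  have hRz := hRb z.1 (by linarith)
  have hysq : z.1.2 ^ 2 ≤ 2 * t := by
    rw [← sq_abs]
    nlinarith [abs_nonneg z.1.2]
  have hS : ∀ i j, |(R z.1 i j + R z.1 j i) / 2| ≤ 6 * CR := fun i j =>
    (abs_symm_coeff_le (by positivity) (fun v => (hRz v).1) i j).trans
      (by linarith [mul_le_mul_of_nonneg_left (show z.1.2 ^ 2 ≤ 2 by linarith) hCR.le])
  have hS' : ∀ i j, ∀ v : Esp m × ℝ, ‖v‖ ≤ 1 →
      |fderiv ℝ (fun w => (R w i j + R w j i) / 2) z.1 v| ≤ 6 * CR * t := fun i j v hv =>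
    (abs_fderiv_symm_coeff_le (by positivity) hRd (fun v => (hRz v).2) i j v hv).trans
      (by linarith [mul_le_mul_of_nonneg_left hy hCR.le])
  have hCRt : CR * t ≤ CR := mul_le_of_le_one_right hCR.le (by linarith)
  have hA0t : A0 * t ≤ A0 / 2 := by linarith [mul_le_mul_of_nonneg_left ht2 hA0.le]
  have hKt : 2 * t * cρ ≤ K * t := by
    have : 2 * cρ ≤ K := by linarith
    linarith [mul_le_mul_of_nonneg_right this ht.le]
  refine poissonBracket_pPsi_pos (fun i j => (hQd i j).1) (fun i => (hηd i).1) hP hmP hKP hmKP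
    hK.le ht (by linarith) htP htc ?_ ?_ ?_ ?_ ?_ ?_ ?_ hp
  · intro i j
    have h1 := abs_le.1 (hAB z.1.1 hz2 i j).1
    have h2 := abs_le.1 (abs_mul_le_mul hy (hAB z.1.1 hz2 i j).2.1)
    have h3 := abs_le.1 (hS i j)
    rw [coefMatrix, abs_le]; constructor <;> linarith
  · intro i j k
    rw [(hQd i j).2]
    have h1 := abs_le.1 ((hAB z.1.1 hz2 i j).2.2 k).1
    have h2 := abs_le.1 (abs_mul_le_mul hy ((hAB z.1.1 hz2 i j).2.2 k).2)
    have h3 := abs_le.1 (hS' i j (EuclideanSpace.single k (1 : ℝ), (0 : ℝ))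
      (by simp [Prod.norm_def]))
    rw [abs_le]; constructor <;> dsimp only <;> linarith
  · intro i j
    rw [(hQd i j).2]
    have h1 := abs_le.1 (hAB z.1.1 hz2 i j).2.1
    have h3 := abs_le.1 (hS' i j ((0 : Esp m), (1 : ℝ)) (by simp [Prod.norm_def]))
    simp only [map_zero]
    rw [abs_le]; constructor <;> linarith
  · intro i j
    rw [(hQd i j).2]
    have h3 := abs_le.1 (hS' i j ((0 : Esp m), (1 : ℝ)) (by simp [Prod.norm_def]))
    have hKt' : 6 * CR * t ≤ K * t := by
      have : 6 * CR ≤ K := by linarith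
      exact mul_le_mul_of_nonneg_right this ht.le
    simp only [map_zero]
    rw [abs_le]; constructor <;> linarith
  · intro i
    refine le_trans (abs_mul_le_mul (c := 2 * t) (d := cρ)
      (by rw [abs_of_pos (by positivity)]; linarith) ?_) hKt
    have h := (fderiv ℝ ρ z.1.1).le_opNorm (EuclideanSpace.single i 1)
    simp only [PiLp.norm_single, norm_one, mul_one] at h
    exact h.trans (hρ1 _)
  · intro i k
    rw [(hηd i).2]
    refine le_trans (abs_mul_le_mul (c := 2 * t) (d := cρ)
      (by rw [abs_of_pos (by positivity)]; linarith) ?_) hKt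
    have h := (fderiv ℝ (fderiv ℝ ρ) z.1.1).le_opNorm₂ (EuclideanSpace.single k 1)
      (EuclideanSpace.single i 1)
    simp only [PiLp.norm_single, norm_one, mul_one] at h
    exact h.trans (hρ2 _)
  · have h1 := hAlow z.1.1 hz2 z.2.1
    have h2 := hBlow z.1.1 hz2 z.2.1
    linarith [mul_le_mul_of_nonneg_left h1 hCY.le]

end
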